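/- Let n ≥ 2, ε > 0, δ < 1/√(n−1) with δ ≥ 0, and R > 0. There is a constant C = C(n, δ, ε) such that: if u is a smooth solution to the special Lagrangian equation ∑_{i=1}^n arctan λᵢ(x) = c on all of ℝⁿ satisfying 3 + (1−ε)λᵢ(x)² + 2λᵢ(x)λⱼ(x) ≥ 0 for all i, j and all x, and |∇u(x)| ≤ δ|x| for all |x| ≥ R, then |D²u(p)| ≤ C for every p ∈ ℝⁿ. -/

import Mathlib

noncomputable section

/-- The Hessian matrix `D²u(x)`, with entries `∂ᵢ∂ⱼ u (x)`. -/
def Hess {n : ℕ} (u : EuclideanSpace ℝ (Fin n) → ℝ) (x : EuclideanSpace ℝ (Fin n)) :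
    Matrix (Fin n) (Fin n) ℝ :=
  Matrix.of fun i j =>
    iteratedFDeriv ℝ 2 u x ![EuclideanSpace.single i 1, EuclideanSpace.single j 1]

/-- The induced metric `g = I + D²u · D²u` on the gradient graph `(x, ∇u(x))`. -/
def gMat {n : ℕ} (u : EuclideanSpace ℝ (Fin n) → ℝ) (x : EuclideanSpace ℝ (Fin n)) :
    Matrix (Fin n) (Fin n) ℝ :=
  1 + Hess u x * Hess u x

/-- The Laplace–Beltrami operator `Δ_g v = ∑ g^{ij} ∂ᵢ∂ⱼ v` of the induced metric. -/
def lapg {n : ℕ} (u v : EuclideanSpace ℝ (Fin n) → ℝ) (x : EuclideanSpace ℝ (Fin n)) : ℝ :=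
  ∑ i, ∑ j, (gMat u x)⁻¹ i j *
    iteratedFDeriv ℝ 2 v x ![EuclideanSpace.single i 1, EuclideanSpace.single j 1]

/-- The squared metric gradient norm `|∇_g v|²_g = ∑ g^{ij} ∂ᵢv ∂ⱼv`. -/
def gradSq {n : ℕ} (u v : EuclideanSpace ℝ (Fin n) → ℝ) (x : EuclideanSpace ℝ (Fin n)) : ℝ :=
  ∑ i, ∑ j, (gMat u x)⁻¹ i j * fderiv ℝ v x (EuclideanSpace.single i 1) *
    fderiv ℝ v x (EuclideanSpace.single j 1)

/-- The volume element `V = √(det g)`. -/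
def Vol {n : ℕ} (u : EuclideanSpace ℝ (Fin n) → ℝ) (x : EuclideanSpace ℝ (Fin n)) : ℝ :=
  Real.sqrt ((gMat u x).det)

end


open Filter Topology

theorem slag_hasDerivAt_det {n : ℕ} (A : ℝ → Matrix (Fin n) (Fin n) ℂ)
    (A' : Matrix (Fin n) (Fin n) ℂ) (t : ℝ)
    (h : ∀ i j, HasDerivAt (fun s => A s i j) (A' i j) t) :
    HasDerivAt (fun s => (A s).det) (∑ i, ∑ k, (A t).adjugate i k * A' k i) t := by
  have h1 : HasDerivAt (fun s => (A s).det)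
      (∑ σ : Equiv.Perm (Fin n), ((Equiv.Perm.sign σ : ℤ) : ℂ) *
        ∑ i, (∏ j ∈ Finset.univ.erase i, A t (σ j) j) • A' (σ i) i) t := by
    simp_rw [Matrix.det_apply']
    refine HasDerivAt.fun_sum fun σ _ => ?_
    refine HasDerivAt.const_mul _ ?_
    exact HasDerivAt.fun_finsetProd (fun i _ => h (σ i) i)
  convert h1 using 1
  have h2 : ∀ i, ∑ k, (A t).adjugate i k * A' k i
      = ((A t).updateCol i (fun k => A' k i)).det := by
    intro i
    rw [← Matrix.cramer_apply, Matrix.cramer_eq_adjugate_mulVec]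
    rfl
  simp_rw [h2, Matrix.det_apply', Finset.mul_sum]
  rw [Finset.sum_comm]
  refine Finset.sum_congr rfl fun σ _ => Finset.sum_congr rfl fun i _ => ?_
  congr 1
  rw [← Finset.mul_prod_erase _ _ (Finset.mem_univ i), smul_eq_mul, mul_comm]
  congr 1
  · refine Finset.prod_congr rfl fun j hj => ?_
    rw [Matrix.updateCol_ne (Finset.ne_of_mem_erase hj)]
  · simp

/-- Second-order data of a curve at `0`. -/
theorem slag_det_second {n : ℕ} (A A1 : ℝ → Matrix (Fin n) (Fin n) ℂ)
    (S : Matrix (Fin n) (Fin n) ℂ) (α : Fin n → ℂ)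
    (h : ∀ t i j, HasDerivAt (fun s => A s i j) (A1 t i j) t)
    (h1 : ∀ i j, HasDerivAt (fun s => A1 s i j) (S i j) 0)
    (h0 : A 0 = Matrix.diagonal α) (hd : ∀ t, (A t).det ≠ 0) :
    ∃ f : ℝ → ℂ, (∀ t, HasDerivAt (fun s => (A s).det) ((A t).det * f t) t) ∧
      f 0 = ∑ i, (α i)⁻¹ * A1 0 i i ∧
      HasDerivAt f (∑ i, (α i)⁻¹ * S i i
        - ∑ i, ∑ k, (α i)⁻¹ * (α k)⁻¹ * (A1 0 i k * A1 0 k i)) 0 := by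
  have hα : ∀ i, α i ≠ 0 := by
    have := hd 0
    rw [h0, Matrix.det_diagonal, Finset.prod_ne_zero_iff] at this
    exact fun i => this i (Finset.mem_univ i)
  have hB0 : (A 0)⁻¹ = Matrix.diagonal fun i => (α i)⁻¹ := by
    apply Matrix.inv_eq_left_inv
    rw [h0, Matrix.diagonal_mul_diagonal]
    simp [hα]
  have hBd : ∀ i k, DifferentiableAt ℝ (fun s => (A s)⁻¹ i k) 0 := by
    intro i k
    have : (fun s => (A s)⁻¹ i k) = fun s => ((A s).det)⁻¹ * (A s).adjugate i k := by
      ext s; rw [Matrix.inv_def]; simp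
    rw [this]
    refine DifferentiableAt.mul ?_ ?_
    · exact ((slag_hasDerivAt_det A _ 0 (h 0)).differentiableAt).inv (hd 0)
    · simp_rw [Matrix.adjugate_apply]
      have h2 := slag_hasDerivAt_det (fun s => (A s).updateRow k (Pi.single i 1))
        ((A1 0).updateRow k 0) 0 (by
          intro a b
          by_cases hak : a = k
          · subst hak; simp only [Matrix.updateRow_self]; exact hasDerivAt_const _ _
          · simp only [Matrix.updateRow_ne hak]; exact h 0 a b)
      exact h2.differentiableAt
  have hBder : ∀ i k, HasDerivAt (fun s => (A s)⁻¹ i k) (- ((α i)⁻¹ * (α k)⁻¹ * A1 0 i k)) 0 := by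
    intro i k
    have e1 : HasDerivAt (fun s => ∑ j, (A s)⁻¹ i j * A s j k)
        (∑ j, (deriv (fun s => (A s)⁻¹ i j) 0 * A 0 j k + (A 0)⁻¹ i j * A1 0 j k)) 0 :=
      HasDerivAt.fun_sum fun j _ => (hBd i j).hasDerivAt.mul (h 0 j k)
    have e2 : (fun s => ∑ j, (A s)⁻¹ i j * A s j k) = fun _ => (1 : Matrix _ _ ℂ) i k := by
      ext s
      rw [← Matrix.mul_apply, Matrix.nonsing_inv_mul _ (isUnit_iff_ne_zero.mpr (hd s))]
    rw [e2] at e1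
    have e3 := e1.unique (hasDerivAt_const _ _)
    rw [Finset.sum_add_distrib, hB0, h0] at e3
    simp only [Matrix.diagonal_apply, mul_ite, mul_zero, ite_mul, zero_mul, Finset.sum_ite_eq,
      Finset.sum_ite_eq', Finset.mem_univ, if_true] at e3
    have e4 := (hBd i k).hasDerivAt
    have := hα k
    have e5 : deriv (fun s => (A s)⁻¹ i k) 0 = -((α i)⁻¹ * A1 0 i k) / α k := by
      rw [eq_div_iff this]; linear_combination e3
    rw [e5] at e4
    have e6 : -((α i)⁻¹ * (α k)⁻¹ * A1 0 i k) = -((α i)⁻¹ * A1 0 i k) / α k := by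
      rw [div_eq_mul_inv]; ring
    rw [e6]; exact e4
  refine ⟨fun t => ∑ i, ∑ k, (A t)⁻¹ i k * A1 t k i, ?_, ?_, ?_⟩
  · intro t
    convert slag_hasDerivAt_det A (A1 t) t (h t) using 1
    rw [Finset.mul_sum]
    refine Finset.sum_congr rfl fun i _ => ?_
    rw [Finset.mul_sum]
    refine Finset.sum_congr rfl fun k _ => ?_
    rw [Matrix.inv_def]
    simp only [Ring.inverse_eq_inv', Matrix.smul_apply, smul_eq_mul]
    field_simp [hd t]
  · simp [hB0, Matrix.diagonal_apply]
  · have : HasDerivAt (fun t => ∑ i, ∑ k, (A t)⁻¹ i k * A1 t k i)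
      (∑ i, ∑ k, (- ((α i)⁻¹ * (α k)⁻¹ * A1 0 i k) * A1 0 k i + (A 0)⁻¹ i k * S k i)) 0 :=
      HasDerivAt.fun_sum fun i _ => HasDerivAt.fun_sum fun k _ => (hBder i k).mul (h1 k i)
    convert this using 1
    simp_rw [Finset.sum_add_distrib, hB0]
    simp only [Matrix.diagonal_apply, ite_mul, zero_mul, Finset.sum_ite_eq,
      Finset.mem_univ, if_true, neg_mul, Finset.sum_neg_distrib]
    rw [sub_eq_neg_add]
    simp only [mul_assoc]

theorem slag_one_inv (l : ℝ) : (1 + Complex.I * (l : ℂ))⁻¹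
    = ((1 / (1 + l^2) : ℝ) : ℂ) + Complex.I * ((- l / (1 + l^2) : ℝ) : ℂ) := by
  have h : (1 + l^2 : ℝ) ≠ 0 := by positivity
  have h' : (1 + (l:ℂ)^2) ≠ 0 := by exact_mod_cast h
  have : (1 + Complex.I * (l : ℂ)) ≠ 0 := by
    intro hh
    have := congrArg Complex.re hh
    simp at this
  field_simp
  push_cast
  field_simp
  linear_combination (l:ℂ)^2 * (Complex.I_sq)

theorem slag_line {n : ℕ} (M M1 : ℝ → Matrix (Fin n) (Fin n) ℝ)
    (S : Matrix (Fin n) (Fin n) ℝ) (l : Fin n → ℝ) (V : ℝ → ℝ) (c : ℝ)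
    (h : ∀ t i j, HasDerivAt (fun s => M s i j) (M1 t i j) t)
    (h1 : ∀ i j, HasDerivAt (fun s => M1 s i j) (S i j) 0)
    (h0 : M 0 = Matrix.diagonal l)
    (hsymm : ∀ i j, M1 0 i j = M1 0 j i)
    (hV : ∀ t, 0 < V t)
    (hdet : ∀ t, (1 + Complex.I • (M t).map Complex.ofReal).det
      = (V t : ℂ) * Complex.exp (Complex.I * c)) :
    (∑ i, 1 / (1 + l i ^ 2) * M1 0 i i = 0) ∧
    (∑ i, 1 / (1 + l i ^ 2) * S i i = ∑ i, ∑ k, 1 / (1 + l i ^ 2) * (1 / (1 + l k ^ 2)) *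
        (l i + l k) * M1 0 i k ^ 2) ∧
    ∃ f : ℝ → ℝ, (∀ t, HasDerivAt (fun s => Real.log (V s)) (f t) t) ∧
      f 0 = ∑ i, l i / (1 + l i ^ 2) * M1 0 i i ∧
      HasDerivAt f (∑ i, l i / (1 + l i ^ 2) * S i i +
        ∑ i, ∑ k, 1 / (1 + l i ^ 2) * (1 / (1 + l k ^ 2)) *
        (1 - l i * l k) * M1 0 i k ^ 2) 0 := by
  set A : ℝ → Matrix (Fin n) (Fin n) ℂ := fun t => 1 + Complex.I • (M t).map Complex.ofReal with hA
  set A1 : ℝ → Matrix (Fin n) (Fin n) ℂ := fun t => Complex.I • (M1 t).map Complex.ofReal with hA1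
  have hexp : Complex.exp (Complex.I * c) ≠ 0 := Complex.exp_ne_zero _
  have hd : ∀ t, (A t).det ≠ 0 := by
    intro t; rw [hA]; simp only; rw [hdet t]
    exact mul_ne_zero (by exact_mod_cast (hV t).ne') hexp
  obtain ⟨f, hf1, hf2, hf3⟩ := slag_det_second A A1 (Complex.I • S.map Complex.ofReal)
    (fun i => 1 + Complex.I * (l i : ℂ))
    (by
      intro t i j
      simp only [hA, hA1, Matrix.add_apply, Matrix.smul_apply, Matrix.map_apply, smul_eq_mul]
      exact ((h t i j).ofReal_comp.const_mul _).const_add _)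
    (by
      intro i j
      simp only [hA1, Matrix.smul_apply, Matrix.map_apply, smul_eq_mul]
      exact ((h1 i j).ofReal_comp.const_mul _))
    (by
      simp only [hA, h0]
      ext i j
      by_cases hij : i = j
      · subst hij; simp
      · simp [hij])
    hd
  -- V is differentiable
  have hVd : ∀ t, HasDerivAt (fun s => (V s : ℂ)) ((V t : ℂ) * f t) t := by
    intro t
    have e : (fun s => (V s : ℂ)) = fun s => (A s).det * (Complex.exp (Complex.I * c))⁻¹ := by
      ext s; simp only [hA]; rw [hdet s]; field_simp
    rw [e]
    have e5 : (V t : ℂ) * f t = (A t).det * f t * (Complex.exp (Complex.I * c))⁻¹ := by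
      simp only [hA]; rw [hdet t]; field_simp
    rw [e5]
    exact (hf1 t).mul_const _
  have hre : ∀ t, HasDerivAt V (V t * (f t).re) t := by
    intro t
    have := Complex.reCLM.hasFDerivAt.comp_hasDerivAt t (hVd t)
    have e5 : V t * (f t).re = Complex.reCLM ((V t : ℂ) * f t) := by simp
    rw [e5]
    exact this
  have him : ∀ t, (f t).im = 0 := by
    intro t
    have e1 := Complex.imCLM.hasFDerivAt.comp_hasDerivAt t (hVd t)
    have e2 : (⇑Complex.imCLM ∘ fun s => (V s : ℂ)) = fun _ => 0 := by ext s; simp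
    rw [e2] at e1
    have e3 := e1.unique (hasDerivAt_const _ _)
    simp at e3
    exact e3.resolve_left (hV t).ne'
  have hf3r := Complex.reCLM.hasFDerivAt.comp_hasDerivAt 0 hf3
  have hf3i := Complex.imCLM.hasFDerivAt.comp_hasDerivAt 0 hf3
  have e2 : (⇑Complex.imCLM ∘ f) = fun _ => 0 := by ext s; simp [him]
  rw [e2] at hf3i
  have e3 := hf3i.unique (hasDerivAt_const _ _)
  have key : ∀ i k, (1 + Complex.I * (l i : ℂ))⁻¹ * (1 + Complex.I * (l k : ℂ))⁻¹ *
      (A1 0 i k * A1 0 k i) = ((- (1 / (1 + l i ^ 2) * (1 / (1 + l k ^ 2)) *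
        (1 - l i * l k) * M1 0 i k ^ 2) : ℝ) : ℂ) + Complex.I * ((1 / (1 + l i ^ 2) * (1 / (1 + l k ^ 2)) *
        (l i + l k) * M1 0 i k ^ 2 : ℝ) : ℂ) := by
    intro i k
    rw [slag_one_inv, slag_one_inv]
    simp only [hA1, Matrix.smul_apply, Matrix.map_apply, smul_eq_mul]
    rw [hsymm k i]
    push_cast
    ring_nf
    have i3 : Complex.I ^ 3 = - Complex.I := Complex.I_pow_three
    have i4 : Complex.I ^ 4 = 1 := Complex.I_pow_four
    simp only [Complex.I_sq, i3, i4]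
    ring
  have key1 : ∀ i (x : ℝ), (1 + Complex.I * (l i : ℂ))⁻¹ * (Complex.I * (x : ℂ)) =
      ((l i / (1 + l i ^ 2) * x : ℝ) : ℂ) + Complex.I * ((1 / (1 + l i ^ 2) * x : ℝ) : ℂ) := by
    intro i x
    rw [slag_one_inv]
    push_cast
    ring_nf
    simp only [Complex.I_sq]
    ring
  simp_rw [key] at e3 hf3r
  simp only [hA1, Matrix.smul_apply, Matrix.map_apply, smul_eq_mul] at hf2 e3 hf3r
  simp_rw [key1] at hf2 e3 hf3r
  simp only [Finset.sum_add_distrib, ← Finset.mul_sum, ← Complex.ofReal_sum] at hf2 e3 hf3r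
  have hR : ∀ x y : ℝ, ((x : ℂ) + Complex.I * (y : ℂ)).re = x := by intro x y; simp
  have hI : ∀ x y : ℝ, ((x : ℂ) + Complex.I * (y : ℂ)).im = y := by intro x y; simp
  rw [Complex.imCLM_apply, Complex.sub_im, hI, hI] at e3
  rw [Complex.reCLM_apply, Complex.sub_re, hR, hR] at hf3r
  refine ⟨?_, ?_, fun t => (f t).re, ?_, ?_, ?_⟩
  · have := him 0
    rwa [hf2, hI] at this
  · linarith
  · intro t
    have e5 : (f t).re = V t * (f t).re / V t := by
      have := (hV t).ne'
      field_simp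
    have hh := (hre t).log (hV t).ne'
    rw [← e5] at hh
    exact hh
  · simp only
    rw [hf2, hR]
  · simp only [Finset.sum_neg_distrib, sub_neg_eq_add] at hf3r
    exact hf3r

/-- Second derivative test at a max for `log φ + s b`. -/
theorem slag_second_test (F F1 : ℝ → ℝ) (F2 : ℝ)
    (h1 : ∀ᶠ t in 𝓝 0, HasDerivAt F (F1 t) t) (h2 : HasDerivAt F1 F2 0)
    (hmax : IsLocalMax F 0) : F1 0 = 0 ∧ F2 ≤ 0 := by
  have hd0 : HasDerivAt F (F1 0) 0 := h1.self_of_nhds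
  have h0 : F1 0 = 0 := hmax.hasDerivAt_eq_zero hd0
  refine ⟨h0, ?_⟩
  by_contra hpos
  push Not at hpos
  have hde : deriv F =ᶠ[𝓝 0] F1 := h1.mono fun t ht => ht.deriv
  have hdd : deriv (deriv F) 0 = F2 := by rw [hde.deriv_eq]; exact h2.deriv
  have hmin := isLocalMin_of_deriv_deriv_pos (f := F) (x₀ := 0) (by rw [hdd]; exact hpos)
    (by rw [hd0.deriv, h0]) hd0.continuousAt
  have hc : F =ᶠ[𝓝 0] fun _ => F 0 := by
    filter_upwards [hmax, hmin] with t ha hb using le_antisymm ha hb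
  have : deriv F =ᶠ[𝓝 0] fun _ => 0 := by
    have := hc.deriv
    simpa using this
  rw [this.deriv_eq] at hdd
  simp at hdd
  linarith

theorem slag_log_test (φ φ1 b b1 : ℝ → ℝ) (φ2 b2 s : ℝ)
    (h1 : ∀ t, HasDerivAt φ (φ1 t) t) (h2 : HasDerivAt φ1 φ2 0)
    (h3 : ∀ t, HasDerivAt b (b1 t) t) (h4 : HasDerivAt b1 b2 0)
    (hpos : 0 < φ 0)
    (hmax : ∀ t, 0 < φ t → Real.log (φ t) + s * b t ≤ Real.log (φ 0) + s * b 0) :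
    φ2 / φ 0 + s * (b2 - s * b1 0 ^ 2) ≤ 0 := by
  have hev : ∀ᶠ t in 𝓝 0, 0 < φ t := (h1 0).continuousAt.eventually (lt_mem_nhds hpos)
  have := slag_second_test (fun t => Real.log (φ t) + s * b t) (fun t => φ1 t / φ t + s * b1 t)
    ((φ2 * φ 0 - φ1 0 * φ1 0) / φ 0 ^ 2 + s * b2)
    (by
      filter_upwards [hev] with t ht
      exact ((h1 t).log ht.ne').add ((h3 t).const_mul s))
    ((h2.div (h1 0) hpos.ne').add (h4.const_mul s))
    (by filter_upwards [hev] with t ht using hmax t ht)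
  obtain ⟨e1, e2⟩ := this
  have e3 : φ1 0 / φ 0 = - (s * b1 0) := by linarith
  have e4 : (φ2 * φ 0 - φ1 0 * φ1 0) / φ 0 ^ 2 = φ2 / φ 0 - (φ1 0 / φ 0)^2 := by
    field_simp
  rw [e4, e3] at e2
  nlinarith

/-- two nonnegative, one nonpositive -/
theorem slag_q_aux (x y a : ℝ) (hx : 0 ≤ x) (hy : 0 ≤ y) (hxy : y ≤ x) (ha : 0 ≤ a)
    (h1 : 0 ≤ 3 + x ^ 2 - 2 * x * a) (h2 : 0 ≤ 3 + y ^ 2 - 2 * y * a)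
    (h3 : 0 ≤ 3 + a ^ 2 - 2 * x * a) : 0 ≤ 3 + x * y - a * x - a * y := by
  rcases le_or_gt a y with h | h
  · nlinarith [mul_nonneg (sub_nonneg.2 hxy) (sub_nonneg.2 h)]
  · rcases le_or_gt (a ^ 2) 3 with h4 | h4
    · have ha0 : 0 < a := lt_of_le_of_lt hy h
      have : 0 ≤ 2 * a * (3 + x * y - a * x - a * y) := by
        nlinarith [mul_nonneg (sub_nonneg.2 h.le) h3, mul_nonneg (sub_nonneg.2 h4) (add_nonneg ha hy)]
      by_contra hh
      push Not at hh
      nlinarith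
    · have ha0 : 0 < a := lt_of_le_of_lt hy h
      -- x ≤ a
      have hxa : x ≤ a := by
        by_contra hh
        push Not at hh
        nlinarith
      have e1 : a ^ 2 - 3 ≤ (a - x) ^ 2 := by nlinarith
      have e2 : a - x ≤ a - y := by linarith
      nlinarith [mul_le_mul_of_nonneg_left e2 (sub_nonneg.2 hxa)]

theorem slag_q_aux2 (x y a : ℝ) (hx : 0 ≤ x) (hy : 0 ≤ y) (ha : 0 ≤ a)
    (h1 : 0 ≤ 3 + x ^ 2 - 2 * x * a) (h2 : 0 ≤ 3 + y ^ 2 - 2 * y * a)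
    (h3 : 0 ≤ 3 + a ^ 2 - 2 * x * a) (h4 : 0 ≤ 3 + a ^ 2 - 2 * y * a) :
    0 ≤ 3 + x * y - a * x - a * y := by
  rcases le_total y x with h | h
  · exact slag_q_aux x y a hx hy h ha h1 h2 h3
  · linarith [slag_q_aux y x a hy hx h ha h2 h1 h4]

theorem slag_q (x y z : ℝ)
    (hxy : 0 ≤ 3 + x ^ 2 + 2 * x * y) (hxz : 0 ≤ 3 + x ^ 2 + 2 * x * z)
    (hyx : 0 ≤ 3 + y ^ 2 + 2 * y * x) (hyz : 0 ≤ 3 + y ^ 2 + 2 * y * z)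
    (hzx : 0 ≤ 3 + z ^ 2 + 2 * z * x) (hzy : 0 ≤ 3 + z ^ 2 + 2 * z * y) :
    0 ≤ 3 + x * y + y * z + z * x := by
  rcases le_total 0 x with hx | hx <;> rcases le_total 0 y with hy | hy <;>
    rcases le_total 0 z with hz | hz
  · positivity
  · linarith [slag_q_aux2 x y (-z) hx hy (by linarith) (by linarith) (by linarith) (by linarith)
      (by linarith)]
  · linarith [slag_q_aux2 x z (-y) hx hz (by linarith) (by linarith) (by linarith) (by linarith)
      (by linarith)]
  · linarith [slag_q_aux2 (-y) (-z) x (by linarith) (by linarith) hx (by linarith) (by linarith)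
      (by linarith) (by linarith)]
  · linarith [slag_q_aux2 y z (-x) hy hz (by linarith) (by linarith) (by linarith) (by linarith)
      (by linarith)]
  · linarith [slag_q_aux2 (-x) (-z) y (by linarith) (by linarith) hy (by linarith) (by linarith)
      (by linarith) (by linarith)]
  · linarith [slag_q_aux2 (-x) (-y) z (by linarith) (by linarith) hz (by linarith) (by linarith)
      (by linarith) (by linarith)]
  · nlinarith [mul_nonneg_of_nonpos_of_nonpos hx hy, mul_nonneg_of_nonpos_of_nonpos hy hz,
      mul_nonneg_of_nonpos_of_nonpos hz hx]

theorem slag_jacobi {n : ℕ} (hn : 0 < n) (ε : ℝ) (hε : 0 < ε) (l g : Fin n → ℝ)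
    (hg : ∀ i, 0 < g i) (T : Fin n → Fin n → Fin n → ℝ) (Q : Fin n → Fin n → ℝ)
    (hT1 : ∀ i j k, T i j k = T j i k) (hT2 : ∀ i j k, T i j k = T i k j)
    (hQ : ∀ i k, Q i k = Q k i)
    (hl : ∀ i j, 0 ≤ 3 + (1 - ε) * l i ^ 2 + 2 * l i * l j)
    (hQe : ∀ k, ∑ i, g i * Q i k = ∑ i, ∑ m, g i * g m * (l i + l m) * T i m k ^ 2) :
    0 ≤ ∑ k, g k * ((∑ i, l i * g i * Q i k +
        ∑ i, ∑ m, g i * g m * (1 - l i * l m) * T i m k ^ 2)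
        - ε / (3 * n) * (∑ i, l i * g i * T i i k) ^ 2) := by
  have hl' : ∀ i j, ε * l i ^ 2 ≤ 3 + l i ^ 2 + 2 * l i * l j := fun i j => by
    linarith [hl i j]
  have hl0 : ∀ i j, 0 ≤ 3 + l i ^ 2 + 2 * l i * l j := fun i j =>
    le_trans (by positivity) (hl' i j)
  set W : Fin n → Fin n → Fin n → ℝ := fun i j k => g i * g j * g k * T i j k ^ 2 with hW
  have hW0 : ∀ i j k, 0 ≤ W i j k := fun i j k => by
    have := hg i; have := hg j; have := hg k
    simp only [hW]; positivity
  -- cyclic invariance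
  have hcyc : ∀ i j k, W i j k = W j k i := fun i j k => by
    simp only [hW]; rw [hT1 i j k, hT2 j i k]; ring
  -- Laplacian
  have e1 : ∑ k, g k * (∑ i, l i * g i * Q i k +
        ∑ i, ∑ m, g i * g m * (1 - l i * l m) * T i m k ^ 2)
      = ∑ k, ∑ i, ∑ m, W i m k * (1 - l i * l m + l k * l i + l k * l m) := by
    have : ∑ k, g k * ∑ i, l i * g i * Q i k
        = ∑ k, ∑ i, ∑ m, W i m k * (l k * l i + l k * l m) := by
      calc ∑ k, g k * ∑ i, l i * g i * Q i k
          = ∑ i, l i * g i * ∑ k, g k * Q k i := by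
            simp_rw [Finset.mul_sum]
            rw [Finset.sum_comm]
            refine Finset.sum_congr rfl fun i _ => Finset.sum_congr rfl fun k _ => ?_
            rw [hQ i k]; ring
        _ = _ := by
            refine Finset.sum_congr rfl fun k _ => ?_
            rw [hQe k]
            simp_rw [Finset.mul_sum]
            refine Finset.sum_congr rfl fun i _ => Finset.sum_congr rfl fun m _ => ?_
            simp only [hW]; ring
    simp_rw [mul_add, Finset.sum_add_distrib]
    simp_rw [mul_add, Finset.sum_add_distrib] at this
    rw [this]
    have : ∑ k, g k * ∑ i, ∑ m, g i * g m * (1 - l i * l m) * T i m k ^ 2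
        = ∑ k, ∑ i, ∑ m, W i m k * (1 - l i * l m) := by
      simp_rw [Finset.mul_sum]
      refine Finset.sum_congr rfl fun k _ => Finset.sum_congr rfl fun i _ =>
        Finset.sum_congr rfl fun m _ => ?_
      simp only [hW]; ring
    rw [this]; ring
  have hrot : ∀ F : Fin n → Fin n → Fin n → ℝ,
      ∑ k, ∑ i, ∑ m, F k i m = ∑ k, ∑ i, ∑ m, F i m k := by
    intro F
    rw [Finset.sum_comm]
    conv_rhs => rw [Finset.sum_comm]
    conv_rhs => enter [2, i]; rw [Finset.sum_comm]
    rw [Finset.sum_comm]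
  have e2 : 3 * ∑ k, ∑ i, ∑ m, W i m k * (1 - l i * l m + l k * l i + l k * l m)
      = ∑ k, ∑ i, ∑ m, W i m k * (3 + l i * l m + l m * l k + l k * l i) := by
    set c : Fin n → Fin n → Fin n → ℝ :=
      fun k i m => W i m k * (1 - l i * l m + l k * l i + l k * l m) with hc
    have r1 := hrot c
    have r2 := hrot (fun k i m => c i m k)
    have : 3 * ∑ k, ∑ i, ∑ m, c k i m
        = ∑ k, ∑ i, ∑ m, (c k i m + c i m k + c m k i) := by
      simp_rw [Finset.sum_add_distrib]
      linarith
    rw [this]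
    refine Finset.sum_congr rfl fun k _ => Finset.sum_congr rfl fun i _ =>
        Finset.sum_congr rfl fun m _ => ?_
    simp only [hc]
    rw [← hcyc i m k, hcyc k i m]; ring
  have e3 : ∑ k, ∑ i, W i i k * (ε * l i ^ 2)
      ≤ ∑ k, ∑ i, ∑ m, W i m k * (3 + l i * l m + l m * l k + l k * l i) := by
    refine Finset.sum_le_sum fun k _ => Finset.sum_le_sum fun i _ => ?_
    have h1 : W i i k * (ε * l i ^ 2) ≤ W i i k * (3 + l i * l i + l i * l k + l k * l i) :=
      mul_le_mul_of_nonneg_left (by linarith [hl' i k]) (hW0 _ _ _)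
    refine h1.trans ?_
    refine Finset.single_le_sum (f := fun m => W i m k * (3 + l i * l m + l m * l k + l k * l i))
      (fun m _ => mul_nonneg (hW0 _ _ _) ?_) (Finset.mem_univ i)
    exact slag_q _ _ _ (hl0 _ _) (hl0 _ _) (hl0 _ _) (hl0 _ _) (hl0 _ _) (hl0 _ _)
  have e4 : ∑ k, g k * (∑ i, l i * g i * T i i k) ^ 2 ≤ n * ∑ k, ∑ i, W i i k * l i ^ 2 := by
    rw [Finset.mul_sum]
    refine Finset.sum_le_sum fun k _ => ?_
    have := sq_sum_le_card_mul_sum_sq (s := Finset.univ) (f := fun i => l i * g i * T i i k)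
    simp only [Finset.card_univ, Fintype.card_fin] at this
    calc _ ≤ g k * (n * ∑ i, (l i * g i * T i i k) ^ 2) :=
          mul_le_mul_of_nonneg_left this (hg k).le
      _ = _ := by
        rw [mul_left_comm, Finset.mul_sum]
        congr 1
        refine Finset.sum_congr rfl fun i _ => ?_
        simp only [hW]; ring
  have hms : ∀ (k : Fin n) (x y : ℝ), g k * (x - y) = g k * x - g k * y :=
    fun k x y => mul_sub _ _ _
  simp only [hms, Finset.sum_sub_distrib]
  rw [e1]
  have e5 : ∑ k, g k * (ε / (3 * n) * (∑ i, l i * g i * T i i k) ^ 2)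
      = ε / (3 * n) * ∑ k, g k * (∑ i, l i * g i * T i i k) ^ 2 := by
    rw [Finset.mul_sum]
    exact Finset.sum_congr rfl fun k _ => by ring
  have e6 : ∑ k, ∑ i, W i i k * (ε * l i ^ 2) = ε * ∑ k, ∑ i, W i i k * l i ^ 2 := by
    simp_rw [Finset.mul_sum]
    exact Finset.sum_congr rfl fun k _ => Finset.sum_congr rfl fun i _ => by ring
  rw [e5]
  have hnr : (0:ℝ) < n := by exact_mod_cast hn
  have e7 := mul_le_mul_of_nonneg_left e4 (by positivity : 0 ≤ ε / (3 * (n:ℝ)))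
  have e8 : ε / (3 * (n:ℝ)) * (n * ∑ k, ∑ i, W i i k * l i ^ 2)
      = (ε * ∑ k, ∑ i, W i i k * l i ^ 2) / 3 := by field_simp
  linarith


noncomputable def slagD {n : ℕ} (v : EuclideanSpace ℝ (Fin n)) (f : EuclideanSpace ℝ (Fin n) → ℝ) :
    EuclideanSpace ℝ (Fin n) → ℝ := fun x => fderiv ℝ f x v

theorem slagD_contDiff {n : ℕ} (v : EuclideanSpace ℝ (Fin n)) (f : EuclideanSpace ℝ (Fin n) → ℝ)
    (hf : ContDiff ℝ (⊤ : ℕ∞) f) : ContDiff ℝ (⊤ : ℕ∞) (slagD v f) := by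
  have h : ContDiff ℝ (⊤ : ℕ∞) (fderiv ℝ f) := hf.fderiv_right (by simp)
  exact h.clm_apply contDiff_const

theorem slagD_apply2 {n : ℕ} (v w : EuclideanSpace ℝ (Fin n)) (f : EuclideanSpace ℝ (Fin n) → ℝ)
    (hf : ContDiff ℝ (⊤ : ℕ∞) f) (x : EuclideanSpace ℝ (Fin n)) :
    slagD v (slagD w f) x = fderiv ℝ (fderiv ℝ f) x v w := by
  have h : ContDiff ℝ (⊤ : ℕ∞) (fderiv ℝ f) := hf.fderiv_right (by simp)
  have h2 : DifferentiableAt ℝ (fderiv ℝ f) x := h.differentiable (by simp) x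
  have h3 : HasFDerivAt (fun y => fderiv ℝ f y w) _ x :=
    h2.hasFDerivAt.clm_apply (hasFDerivAt_const w x)
  unfold slagD
  rw [h3.fderiv]
  simp

theorem slagD_comm {n : ℕ} (v w : EuclideanSpace ℝ (Fin n)) (f : EuclideanSpace ℝ (Fin n) → ℝ)
    (hf : ContDiff ℝ (⊤ : ℕ∞) f) : slagD v (slagD w f) = slagD w (slagD v f) := by
  ext x
  rw [slagD_apply2 v w f hf, slagD_apply2 w v f hf]
  exact (hf.contDiffAt.isSymmSndFDerivAt (by
    simp only [minSmoothness_of_isRCLikeNormedField]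
    exact WithTop.coe_le_coe.mpr (le_top : (2 : ℕ∞) ≤ ⊤))) v w

theorem slagD_line {n : ℕ} (v : EuclideanSpace ℝ (Fin n)) (f : EuclideanSpace ℝ (Fin n) → ℝ)
    (hf : ContDiff ℝ (⊤ : ℕ∞) f) (x : EuclideanSpace ℝ (Fin n)) (t : ℝ) :
    HasDerivAt (fun s : ℝ => f (x + s • v)) (slagD v f (x + t • v)) t := by
  have h1 : HasFDerivAt f (fderiv ℝ f (x + t • v)) (x + t • v) :=
    (hf.differentiable (by simp) _).hasFDerivAt
  have h2 : HasDerivAt (fun s : ℝ => x + s • v) v t := by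
    simpa using ((hasDerivAt_id t).smul_const v).const_add x
  exact h1.comp_hasDerivAt t h2

noncomputable def slagH {n : ℕ} (b : OrthonormalBasis (Fin n) ℝ (EuclideanSpace ℝ (Fin n)))
    (u : EuclideanSpace ℝ (Fin n) → ℝ) (x : EuclideanSpace ℝ (Fin n)) :
    Matrix (Fin n) (Fin n) ℝ := Matrix.of fun i j => slagD (b i) (slagD (b j) u) x

theorem slag_Hess {n : ℕ} (u : EuclideanSpace ℝ (Fin n) → ℝ) (hu : ContDiff ℝ (⊤ : ℕ∞) u)
    (x : EuclideanSpace ℝ (Fin n)) (i j : Fin n) :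
    Hess u x i j = slagD (EuclideanSpace.single i 1) (slagD (EuclideanSpace.single j 1) u) x := by
  rw [slagD_apply2 _ _ _ hu]
  simp [Hess, iteratedFDeriv_two_apply]

theorem slag_expand {n : ℕ} (v : EuclideanSpace ℝ (Fin n)) :
    v = ∑ i, v i • EuclideanSpace.single i (1:ℝ) := by
  have := (EuclideanSpace.basisFun (Fin n) ℝ).sum_repr v
  simpa using this.symm

theorem slag_bilin {n : ℕ} (u : EuclideanSpace ℝ (Fin n) → ℝ) (hu : ContDiff ℝ (⊤ : ℕ∞) u)
    (x v w : EuclideanSpace ℝ (Fin n)) :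
    slagD v (slagD w u) x = ∑ i, ∑ j, v i * Hess u x i j * w j := by
  rw [slagD_apply2 _ _ _ hu]
  conv_lhs => rw [slag_expand v, slag_expand w]
  simp only [map_sum, map_smul, sum_apply, smul_apply,
    smul_eq_mul, Finset.mul_sum]
  rw [Finset.sum_comm]
  refine Finset.sum_congr rfl fun i _ => Finset.sum_congr rfl fun j _ => ?_
  rw [slag_Hess u hu, slagD_apply2 _ _ _ hu]
  ring

noncomputable def slagU {n : ℕ} (b : OrthonormalBasis (Fin n) ℝ (EuclideanSpace ℝ (Fin n))) :
    Matrix (Fin n) (Fin n) ℝ := Matrix.of fun k i => b i k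

theorem slagU_orth {n : ℕ} (b : OrthonormalBasis (Fin n) ℝ (EuclideanSpace ℝ (Fin n))) :
    (slagU b).transpose * slagU b = 1 := by
  ext i j
  have := orthonormal_iff_ite.mp b.orthonormal i j
  rw [Matrix.mul_apply, Matrix.one_apply, ← this]
  simp only [slagU, Matrix.transpose_apply, Matrix.of_apply, PiLp.inner_apply]
  refine Finset.sum_congr rfl fun k _ => ?_
  simp [mul_comm]

theorem slagH_eq {n : ℕ} (b : OrthonormalBasis (Fin n) ℝ (EuclideanSpace ℝ (Fin n)))
    (u : EuclideanSpace ℝ (Fin n) → ℝ) (hu : ContDiff ℝ (⊤ : ℕ∞) u) (x : EuclideanSpace ℝ (Fin n)) :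
    slagH b u x = (slagU b).transpose * Hess u x * slagU b := by
  ext i j
  simp only [slagH, Matrix.of_apply]
  rw [slag_bilin u hu, Matrix.mul_apply, Finset.sum_comm]
  refine Finset.sum_congr rfl fun k _ => ?_
  rw [Matrix.mul_apply, Finset.sum_mul]
  rfl

theorem slag_det_rot {n : ℕ} (b : OrthonormalBasis (Fin n) ℝ (EuclideanSpace ℝ (Fin n)))
    (u : EuclideanSpace ℝ (Fin n) → ℝ) (hu : ContDiff ℝ (⊤ : ℕ∞) u) (x : EuclideanSpace ℝ (Fin n)) :
    (1 + Complex.I • (slagH b u x).map Complex.ofReal).det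
      = (1 + Complex.I • (Hess u x).map Complex.ofReal).det := by
  set U : Matrix (Fin n) (Fin n) ℂ := (slagU b).map Complex.ofRealHom with hU
  have h1 : U.transpose * U = 1 := by
    have := congrArg (fun A : Matrix (Fin n) (Fin n) ℝ => A.map Complex.ofRealHom) (slagU_orth b)
    simp only [Matrix.map_mul] at this
    rw [hU, ← Matrix.transpose_map, this]
    simp
  have h2 : (slagH b u x).map Complex.ofReal = U.transpose * (Hess u x).map Complex.ofReal * U := by
    have := congrArg (fun A : Matrix (Fin n) (Fin n) ℝ => A.map Complex.ofRealHom) (slagH_eq b u hu x)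
    simp only [Matrix.map_mul] at this
    rw [hU, ← Matrix.transpose_map]
    exact this
  have h3 : 1 + Complex.I • (slagH b u x).map Complex.ofReal
      = U.transpose * (1 + Complex.I • (Hess u x).map Complex.ofReal) * U := by
    rw [h2, mul_add, add_mul, mul_one, h1]
    simp
  rw [h3, Matrix.det_mul, Matrix.det_mul, mul_right_comm, ← Matrix.det_mul, h1]
  simp

theorem slagH_eig {n : ℕ} (u : EuclideanSpace ℝ (Fin n) → ℝ) (hu : ContDiff ℝ (⊤ : ℕ∞) u)
    (x : EuclideanSpace ℝ (Fin n)) (hs : (Hess u x).IsHermitian) :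
    slagH hs.eigenvectorBasis u x = Matrix.diagonal hs.eigenvalues := by
  ext i j
  simp only [slagH, Matrix.of_apply]
  rw [slag_bilin u hu, Matrix.diagonal_apply]
  have h1 : ∀ k, ∑ m, Hess u x k m * hs.eigenvectorBasis j m
      = hs.eigenvalues j * hs.eigenvectorBasis j k := by
    intro k
    have := congrFun (hs.mulVec_eigenvectorBasis j) k
    simpa [Matrix.mulVec, dotProduct] using this
  simp_rw [mul_assoc, ← Finset.mul_sum, h1]
  have h2 := orthonormal_iff_ite.mp hs.eigenvectorBasis.orthonormal i j
  rw [PiLp.inner_apply] at h2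
  simp only [RCLike.inner_apply, conj_trivial] at h2
  have : ∑ k, hs.eigenvectorBasis i k * (hs.eigenvalues j * hs.eigenvectorBasis j k)
      = hs.eigenvalues j * ∑ k, hs.eigenvectorBasis j k * hs.eigenvectorBasis i k := by
    rw [Finset.mul_sum]; exact Finset.sum_congr rfl fun k _ => by ring
  rw [this, h2]
  by_cases hij : i = j
  · subst hij; simp
  · simp [hij]

theorem slag_polar (l : ℝ) : 1 + Complex.I * (l : ℂ)
    = (Real.sqrt (1 + l ^ 2) : ℂ) * Complex.exp (Complex.I * (Real.arctan l : ℂ)) := by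
  have h : Real.sqrt (1 + l ^ 2) ≠ 0 := by positivity
  have h' : (Real.sqrt (1 + l ^ 2) : ℂ) ≠ 0 := by exact_mod_cast h
  rw [mul_comm Complex.I ((Real.arctan l : ℝ) : ℂ), Complex.exp_mul_I, ← Complex.ofReal_cos,
    ← Complex.ofReal_sin, Real.cos_arctan, Real.sin_arctan]
  push_cast
  field_simp

theorem slag_det {n : ℕ} (u : EuclideanSpace ℝ (Fin n) → ℝ) (hu : ContDiff ℝ (⊤ : ℕ∞) u)
    (x : EuclideanSpace ℝ (Fin n)) (hs : (Hess u x).IsHermitian) (c : ℝ)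
    (hc : ∑ i, Real.arctan (hs.eigenvalues i) = c) :
    (1 + Complex.I • (Hess u x).map Complex.ofReal).det
      = ((∏ i, Real.sqrt (1 + hs.eigenvalues i ^ 2) : ℝ) : ℂ) * Complex.exp (Complex.I * c) := by
  rw [← slag_det_rot hs.eigenvectorBasis u hu x, slagH_eig u hu x hs]
  have : (1 + Complex.I • (Matrix.diagonal hs.eigenvalues).map Complex.ofReal)
      = Matrix.diagonal fun i => 1 + Complex.I * (hs.eigenvalues i : ℂ) := by
    ext i j
    by_cases hij : i = j
    · subst hij; simp
    · simp [hij]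
  rw [this, Matrix.det_diagonal]
  simp_rw [slag_polar]
  rw [Finset.prod_mul_distrib, ← Complex.exp_sum, ← hc]
  push_cast
  rw [Finset.mul_sum]


theorem slag_grad {n : ℕ} (u : EuclideanSpace ℝ (Fin n) → ℝ)
    (b : OrthonormalBasis (Fin n) ℝ (EuclideanSpace ℝ (Fin n))) (x : EuclideanSpace ℝ (Fin n)) :
    ‖gradient u x‖ ^ 2 = ∑ m, slagD (b m) u x ^ 2 := by
  rw [← b.sum_sq_norm_inner_left]
  refine Finset.sum_congr rfl fun m _ => ?_
  have : inner ℝ (gradient u x) (b m) = slagD (b m) u x := by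
    unfold slagD
    rw [← toDual_gradient]
    simp
  rw [this]
  simp

theorem slag_core {n : ℕ} (hn : 0 < n) (ε : ℝ) (hε : 0 < ε) (K ρ c : ℝ)
    (u : EuclideanSpace ℝ (Fin n) → ℝ) (hu : ContDiff ℝ (⊤ : ℕ∞) u)
    (hsym : ∀ x : EuclideanSpace ℝ (Fin n), (Hess u x).IsHermitian)
    (hc : ∀ x, ∑ i, Real.arctan ((hsym x).eigenvalues i) = c)
    (hl : ∀ x, ∀ i j : Fin n,
          0 ≤ 3 + (1 - ε) * ((hsym x).eigenvalues i) ^ 2 +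
            2 * (hsym x).eigenvalues i * (hsym x).eigenvalues j)
    (z : EuclideanSpace ℝ (Fin n))
    (hz : 0 < ρ ^ 2 - ‖z‖ ^ 2 + K * ‖gradient u z‖ ^ 2)
    (hmax : ∀ x, 0 < ρ ^ 2 - ‖x‖ ^ 2 + K * ‖gradient u x‖ ^ 2 →
      Real.log (ρ ^ 2 - ‖x‖ ^ 2 + K * ‖gradient u x‖ ^ 2) + ε / (3 * n) *
        Real.log (∏ i, Real.sqrt (1 + (hsym x).eigenvalues i ^ 2)) ≤
      Real.log (ρ ^ 2 - ‖z‖ ^ 2 + K * ‖gradient u z‖ ^ 2) + ε / (3 * n) *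
        Real.log (∏ i, Real.sqrt (1 + (hsym z).eigenvalues i ^ 2))) :
    ∑ k, 1 / (1 + (hsym z).eigenvalues k ^ 2) * (K * (hsym z).eigenvalues k ^ 2 - 1) ≤ 0 := by
  set b := (hsym z).eigenvectorBasis with hb
  set l := (hsym z).eigenvalues with hldef
  set V : EuclideanSpace ℝ (Fin n) → ℝ :=
    fun x => ∏ i, Real.sqrt (1 + (hsym x).eigenvalues i ^ 2) with hV
  have hVpos : ∀ x, 0 < V x := fun x => Finset.prod_pos fun i _ => by positivity
  set T : Fin n → Fin n → Fin n → ℝ :=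
    fun i j k => slagD (b k) (slagD (b i) (slagD (b j) u)) z with hT
  set Q : Fin n → Fin n → ℝ :=
    fun i k => slagD (b k) (slagD (b k) (slagD (b i) (slagD (b i) u))) z with hQ
  have hu1 : ∀ i, ContDiff ℝ (⊤ : ℕ∞) (slagD (b i) u) := fun i => slagD_contDiff _ _ hu
  have hu2 : ∀ i j, ContDiff ℝ (⊤ : ℕ∞) (slagD (b i) (slagD (b j) u)) :=
    fun i j => slagD_contDiff _ _ (hu1 j)
  have hu3 : ∀ k i j, ContDiff ℝ (⊤ : ℕ∞) (slagD (b k) (slagD (b i) (slagD (b j) u))) :=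
    fun k i j => slagD_contDiff _ _ (hu2 i j)
  have hT1 : ∀ i j k, T i j k = T j i k := fun i j k => by
    simp only [hT]; rw [slagD_comm (b i) (b j) u hu]
  have hT2 : ∀ i j k, T i j k = T i k j := fun i j k => by
    rw [hT1 i j k, hT1 i k j]
    simp only [hT]
    rw [slagD_comm (b k) (b j) _ (hu1 i)]
  have hQs : ∀ i k, Q i k = Q k i := fun i k => by
    simp only [hQ]
    rw [slagD_comm (b k) (b i) _ (hu1 i), slagD_comm (b k) (b i) u hu,
      slagD_comm (b k) (b i) _ (hu2 i k), slagD_comm (b k) (b i) _ (hu1 k)]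
  have hline : ∀ k, _ := fun k => slag_line (fun t => slagH b u (z + t • b k))
    (fun t => Matrix.of fun i j => slagD (b k) (slagD (b i) (slagD (b j) u)) (z + t • b k))
    (Matrix.of fun i j => slagD (b k) (slagD (b k) (slagD (b i) (slagD (b j) u))) z) l
    (fun t => V (z + t • b k)) c
    (fun t i j => slagD_line (b k) _ (hu2 i j) z t)
    (fun i j => by
      have := slagD_line (b k) _ (hu3 k i j) z 0
      simpa using this)
    (by simp only [zero_smul, add_zero]; exact slagH_eig u hu z (hsym z))
    (fun i j => by simpa using hT1 i j k)
    (fun t => hVpos _)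
    (fun t => by
      rw [slag_det_rot b u hu]; exact slag_det u hu _ (hsym _) c (hc _))
  simp only [zero_smul, add_zero, Matrix.of_apply] at hline
  -- test function along the line
  set φ : EuclideanSpace ℝ (Fin n) → ℝ :=
    fun x => ρ ^ 2 - ‖x‖ ^ 2 + K * ‖gradient u x‖ ^ 2 with hφ
  have hphi1 : ∀ k t, HasDerivAt (fun s : ℝ => φ (z + s • b k))
      (- (2 * inner ℝ z (b k) + 2 * t) + K * ∑ m, 2 * slagD (b m) u (z + t • b k) *
        slagD (b k) (slagD (b m) u) (z + t • b k)) t := by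
    intro k t
    have e : (fun s : ℝ => φ (z + s • b k)) = fun s => ρ ^ 2 -
        (‖z‖ ^ 2 + 2 * inner ℝ z (b k) * s + s ^ 2) +
        K * ∑ m, slagD (b m) u (z + s • b k) ^ 2 := by
      ext s
      simp only [hφ]
      rw [slag_grad u b, norm_add_sq_real, inner_smul_right, norm_smul, b.norm_eq_one]
      simp only [Real.norm_eq_abs, mul_one, sq_abs]
      ring
    rw [e]
    have d1 : HasDerivAt (fun s : ℝ => ‖z‖ ^ 2 + 2 * inner ℝ z (b k) * s + s ^ 2)
        (2 * inner ℝ z (b k) + 2 * t) t := by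
      have := (((hasDerivAt_id' t).const_mul (2 * inner ℝ z (b k))).const_add (‖z‖ ^ 2)).fun_add
        ((hasDerivAt_id' t).fun_pow 2)
      simp only [mul_one, Nat.cast_ofNat, Nat.add_one_sub_one, pow_one] at this
      exact this
    have d2 : HasDerivAt (fun s : ℝ => ∑ m, slagD (b m) u (z + s • b k) ^ 2)
        (∑ m, 2 * slagD (b m) u (z + t • b k) * slagD (b k) (slagD (b m) u) (z + t • b k)) t := by
      refine HasDerivAt.fun_sum fun m _ => ?_
      have := (slagD_line (b k) _ (hu1 m) z t).fun_pow 2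
      simp only [Nat.cast_ofNat, Nat.add_one_sub_one, pow_one] at this
      exact this
    exact (d1.const_sub (ρ ^ 2)).add (d2.const_mul K)
  have hphi2 : ∀ k, HasDerivAt (fun t : ℝ => (- (2 * inner ℝ z (b k) + 2 * t) +
        K * ∑ m, 2 * slagD (b m) u (z + t • b k) *
        slagD (b k) (slagD (b m) u) (z + t • b k)))
      (-2 + K * ∑ m, (2 * slagD (b k) (slagD (b m) u) z * slagD (b k) (slagD (b m) u) z +
        2 * slagD (b m) u z * slagD (b k) (slagD (b k) (slagD (b m) u)) z)) 0 := by
    intro k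
    have d1 : HasDerivAt (fun t : ℝ => - (2 * inner ℝ z (b k) + 2 * t)) (-2) 0 := by
      have := (((hasDerivAt_id' (0:ℝ)).const_mul (2:ℝ)).const_add (2 * inner ℝ z (b k))).fun_neg
      simp only [mul_one] at this
      exact this
    refine d1.add (HasDerivAt.const_mul K (HasDerivAt.fun_sum fun m _ => ?_))
    have := ((slagD_line (b k) _ (hu1 m) z 0).const_mul 2).fun_mul
      (slagD_line (b k) _ (hu2 k m) z 0)
    simp only [zero_smul, add_zero] at this
    exact this
  -- Hessian at z
  have hHz : ∀ i j, slagD (b i) (slagD (b j) u) z = if i = j then l i else 0 := by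
    intro i j
    have := congrFun (congrFun (slagH_eig u hu z (hsym z)) i) j
    rw [Matrix.diagonal_apply] at this
    exact this
  have hphi2' : ∀ k, (-2 + K * ∑ m, (2 * slagD (b k) (slagD (b m) u) z *
        slagD (b k) (slagD (b m) u) z +
        2 * slagD (b m) u z * slagD (b k) (slagD (b k) (slagD (b m) u)) z))
      = 2 * (K * l k ^ 2 - 1) + 2 * K * ∑ m, slagD (b m) u z * T k k m := by
    intro k
    rw [Finset.sum_add_distrib]
    have e1 : ∑ m, 2 * slagD (b k) (slagD (b m) u) z * slagD (b k) (slagD (b m) u) z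
        = 2 * l k ^ 2 := by
      simp_rw [hHz]
      simp [sq, mul_assoc]
    have e2 : ∑ m, 2 * slagD (b m) u z * slagD (b k) (slagD (b k) (slagD (b m) u)) z
        = 2 * ∑ m, slagD (b m) u z * T k k m := by
      rw [Finset.mul_sum]
      refine Finset.sum_congr rfl fun m _ => ?_
      rw [hT2 k k m]
      simp only [hT]
      ring
    rw [e1, e2]; ring
  choose h1 h2 f hf1 hf2 hf3 using hline
  have htest : ∀ k, _ := fun k => slag_log_test (fun t : ℝ => φ (z + t • b k)) _
    (fun t : ℝ => Real.log (V (z + t • b k))) (f k) _ _ (ε / (3 * n))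
    (hphi1 k) (hphi2 k) (hf1 k) (hf3 k) (by simpa using hz)
    (fun t ht => by simpa using hmax _ ht)
  simp only [zero_smul, add_zero, hphi2', hf2] at htest
  set g : Fin n → ℝ := fun k => 1 / (1 + l k ^ 2) with hg
  have hg0 : ∀ k, 0 < g k := fun k => by simp only [hg]; positivity
  have hlg : ∀ i, l i / (1 + l i ^ 2) = l i * g i := fun i => by simp only [hg]; ring
  have hjac := slag_jacobi hn ε hε l g hg0 T Q hT1 hT2 hQs (hl z) h2
  have hsum : ∑ k, g k * ((2 * (K * l k ^ 2 - 1) + 2 * K * ∑ m, slagD (b m) u z * T k k m) / φ z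
      + ε / (3 * n) * ((∑ i, l i * g i * Q i k +
        ∑ i, ∑ m, g i * g m * (1 - l i * l m) * T i m k ^ 2)
        - ε / (3 * n) * (∑ i, l i * g i * T i i k) ^ 2)) ≤ 0 := by
    refine Finset.sum_nonpos fun k _ => mul_nonpos_of_nonneg_of_nonpos (hg0 k).le ?_
    have := htest k
    simp only [hlg] at this
    exact this
  have hharm : ∑ k, g k * ∑ m, slagD (b m) u z * T k k m = 0 := by
    simp_rw [Finset.mul_sum]
    rw [Finset.sum_comm]
    refine Finset.sum_eq_zero fun m _ => ?_
    have := h1 m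
    calc ∑ k, g k * (slagD (b m) u z * T k k m) = slagD (b m) u z * ∑ k, g k * T k k m := by
          rw [Finset.mul_sum]; exact Finset.sum_congr rfl fun k _ => by ring
      _ = 0 := by
          have e : ∑ k, g k * T k k m = 0 := this
          rw [e, mul_zero]
  have hdec : ∑ k, g k * ((2 * (K * l k ^ 2 - 1) + 2 * K * ∑ m, slagD (b m) u z * T k k m) / φ z
      + ε / (3 * n) * ((∑ i, l i * g i * Q i k +
        ∑ i, ∑ m, g i * g m * (1 - l i * l m) * T i m k ^ 2)
        - ε / (3 * n) * (∑ i, l i * g i * T i i k) ^ 2))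
      = 2 / φ z * ∑ k, g k * (K * l k ^ 2 - 1)
        + 2 * K / φ z * ∑ k, g k * ∑ m, slagD (b m) u z * T k k m
        + ε / (3 * n) * ∑ k, g k * ((∑ i, l i * g i * Q i k +
        ∑ i, ∑ m, g i * g m * (1 - l i * l m) * T i m k ^ 2)
        - ε / (3 * n) * (∑ i, l i * g i * T i i k) ^ 2) := by
    rw [Finset.mul_sum, Finset.mul_sum, Finset.mul_sum, ← Finset.sum_add_distrib,
      ← Finset.sum_add_distrib]
    refine Finset.sum_congr rfl fun k _ => ?_
    ring
  rw [hdec, hharm, mul_zero, add_zero] at hsum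
  have hφz : 0 < φ z := hz
  have hnr : (0:ℝ) < n := by exact_mod_cast hn
  have h3 : 0 ≤ ε / (3 * n) * ∑ k, g k * ((∑ i, l i * g i * Q i k +
        ∑ i, ∑ m, g i * g m * (1 - l i * l m) * T i m k ^ 2)
        - ε / (3 * n) * (∑ i, l i * g i * T i i k) ^ 2) := mul_nonneg (by positivity) hjac
  have h4 : 2 / φ z * ∑ k, g k * (K * l k ^ 2 - 1) ≤ 0 := by linarith
  by_contra hh
  push Not at hh
  have : 0 < 2 / φ z * ∑ k, g k * (K * l k ^ 2 - 1) := mul_pos (by positivity) hh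
  linarith


theorem slag_eig_bound {n : ℕ} (l : Fin n → ℝ) (K : ℝ) (hK0 : 0 < K) (hK : (n:ℝ) - 1 < K)
    (h : ∑ k, 1 / (1 + l k ^ 2) * (K * l k ^ 2 - 1) ≤ 0) (i : Fin n) :
    1 + l i ^ 2 ≤ (K + 1) / (K - ((n:ℝ) - 1)) := by
  have h1 : ∀ k, -1 ≤ 1 / (1 + l k ^ 2) * (K * l k ^ 2 - 1) := by
    intro k
    have : 0 < 1 + l k ^ 2 := by positivity
    rw [one_div, inv_mul_eq_div, le_div_iff₀ this]
    nlinarith [mul_nonneg hK0.le (sq_nonneg (l k)), sq_nonneg (l k)]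
  rw [← Finset.add_sum_erase _ _ (Finset.mem_univ i)] at h
  have h2 : ∑ k ∈ Finset.univ.erase i, (-1:ℝ) ≤
      ∑ k ∈ Finset.univ.erase i, 1 / (1 + l k ^ 2) * (K * l k ^ 2 - 1) :=
    Finset.sum_le_sum fun k _ => h1 k
  have hn : 1 ≤ n := i.pos
  rw [Finset.sum_const, Finset.card_erase_of_mem (Finset.mem_univ i), Finset.card_univ,
    Fintype.card_fin, nsmul_eq_mul, Nat.cast_sub hn, Nat.cast_one] at h2
  have h3 : 1 / (1 + l i ^ 2) * (K * l i ^ 2 - 1) ≤ (n:ℝ) - 1 := by linarith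
  have hp : 0 < 1 + l i ^ 2 := by positivity
  rw [one_div, inv_mul_eq_div, div_le_iff₀ hp] at h3
  rw [le_div_iff₀ (by linarith)]
  nlinarith

theorem slag_V_cont {n : ℕ} (u : EuclideanSpace ℝ (Fin n) → ℝ) (hu : ContDiff ℝ (⊤ : ℕ∞) u)
    (hsym : ∀ x : EuclideanSpace ℝ (Fin n), (Hess u x).IsHermitian) (c : ℝ)
    (hc : ∀ x, ∑ i, Real.arctan ((hsym x).eigenvalues i) = c) :
    Continuous fun x => ∏ i, Real.sqrt (1 + (hsym x).eigenvalues i ^ 2) := by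
  have h1 : (fun x => ∏ i, Real.sqrt (1 + (hsym x).eigenvalues i ^ 2))
      = fun x => ‖(1 + Complex.I • (Hess u x).map Complex.ofReal).det‖ := by
    ext x
    rw [slag_det u hu x (hsym x) c (hc x), norm_mul, mul_comm Complex.I,
      Complex.norm_exp_ofReal_mul_I, mul_one, Complex.norm_real, Real.norm_eq_abs, abs_of_nonneg]
    exact Finset.prod_nonneg fun i _ => Real.sqrt_nonneg _
  rw [h1]
  refine Continuous.norm (Continuous.matrix_det ?_)
  refine continuous_matrix fun i j => ?_
  simp only [Matrix.add_apply, Matrix.smul_apply, Matrix.map_apply, smul_eq_mul]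
  have h2 : Continuous fun x => Hess u x i j := by
    simp_rw [slag_Hess u hu]
    exact (slagD_contDiff _ _ (slagD_contDiff _ _ hu)).continuous
  fun_prop

theorem slag_main {n : ℕ} (hn : 0 < n) (ε : ℝ) (hε : 0 < ε) (δ K R c : ℝ)
    (hK0 : 0 < K) (hK : (n:ℝ) - 1 < K) (hKδ : K * δ ^ 2 < 1)
    (u : EuclideanSpace ℝ (Fin n) → ℝ) (hu : ContDiff ℝ (⊤ : ℕ∞) u)
    (hsym : ∀ x : EuclideanSpace ℝ (Fin n), (Hess u x).IsHermitian)
    (hc : ∀ x, ∑ i, Real.arctan ((hsym x).eigenvalues i) = c)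
    (hl : ∀ x, ∀ i j : Fin n,
          0 ≤ 3 + (1 - ε) * ((hsym x).eigenvalues i) ^ 2 +
            2 * (hsym x).eigenvalues i * (hsym x).eigenvalues j)
    (hgr : ∀ x : EuclideanSpace ℝ (Fin n), R ≤ ‖x‖ → ‖gradient u x‖ ≤ δ * ‖x‖)
    (p : EuclideanSpace ℝ (Fin n)) :
    ∏ i, Real.sqrt (1 + (hsym p).eigenvalues i ^ 2)
      ≤ ∏ _i : Fin n, Real.sqrt ((K + 1) / (K - ((n:ℝ) - 1))) := by
  set M : ℝ := ∏ _i : Fin n, Real.sqrt ((K + 1) / (K - ((n:ℝ) - 1))) with hM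
  set V : EuclideanSpace ℝ (Fin n) → ℝ :=
    fun x => ∏ i, Real.sqrt (1 + (hsym x).eigenvalues i ^ 2) with hV
  have hVpos : ∀ x, 0 < V x := fun x => Finset.prod_pos fun i _ => by positivity
  have hM0 : 0 ≤ M := Finset.prod_nonneg fun i _ => Real.sqrt_nonneg _
  have hVc : Continuous V := slag_V_cont u hu hsym c hc
  have hnr : (0:ℝ) < n := by exact_mod_cast hn
  set s : ℝ := ε / (3 * n) with hs
  have hs0 : 0 < s := by positivity
  have hGc : Continuous fun x => ‖gradient u x‖ ^ 2 := by
    simp_rw [slag_grad u (EuclideanSpace.basisFun (Fin n) ℝ)]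
    exact continuous_finsetSum _ fun m _ => (slagD_contDiff _ _ hu).continuous.pow 2
  have hg2 : ∀ x : EuclideanSpace ℝ (Fin n), R ≤ ‖x‖ →
      K * ‖gradient u x‖ ^ 2 ≤ K * δ ^ 2 * ‖x‖ ^ 2 := by
    intro x hx
    have h1 := hgr x hx
    have h2 : ‖gradient u x‖ ^ 2 ≤ (δ * ‖x‖) ^ 2 := pow_le_pow_left₀ (norm_nonneg _) h1 2
    calc _ ≤ K * (δ * ‖x‖) ^ 2 := mul_le_mul_of_nonneg_left h2 hK0.le
      _ = _ := by ring
  obtain ⟨B0, hB0⟩ := (isCompact_closedBall (0 : EuclideanSpace ℝ (Fin n)) R).exists_bound_of_continuousOn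
    hGc.continuousOn
  set B : ℝ := K * |B0| with hB
  have hB0' : 0 ≤ B := by positivity
  have hφle : ∀ ρ : ℝ, ∀ x, ρ ^ 2 - ‖x‖ ^ 2 + K * ‖gradient u x‖ ^ 2 ≤ ρ ^ 2 + B := by
    intro ρ x
    rcases le_total R ‖x‖ with h | h
    · have := hg2 x h
      nlinarith [sq_nonneg ‖x‖]
    · have h1 := hB0 x (by simpa using h)
      rw [Real.norm_eq_abs, abs_of_nonneg (sq_nonneg _)] at h1
      have h2 : K * ‖gradient u x‖ ^ 2 ≤ K * |B0| :=
        mul_le_mul_of_nonneg_left (h1.trans (le_abs_self _)) hK0.le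
      nlinarith [sq_nonneg ‖x‖]
  have key : ∀ ρ : ℝ, ‖p‖ < ρ → (ρ ^ 2 - ‖p‖ ^ 2) * V p ^ s ≤ (ρ ^ 2 + B) * M ^ s := by
    intro ρ hρ
    set φ : EuclideanSpace ℝ (Fin n) → ℝ :=
      fun x => ρ ^ 2 - ‖x‖ ^ 2 + K * ‖gradient u x‖ ^ 2 with hφ
    have hφc : Continuous φ := by
      have : Continuous fun x : EuclideanSpace ℝ (Fin n) => ‖x‖ ^ 2 := by fun_prop
      exact (continuous_const.sub this).add (continuous_const.mul hGc)
    have hpp : 0 < ρ ^ 2 - ‖p‖ ^ 2 := by nlinarith [norm_nonneg p]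
    have hφp : ρ ^ 2 - ‖p‖ ^ 2 ≤ φ p := by
      have : 0 ≤ K * ‖gradient u p‖ ^ 2 := by positivity
      simp only [hφ]; linarith
    set r : ℝ := |R| + ρ ^ 2 / (1 - K * δ ^ 2) + 1 with hr
    have hd : 0 < 1 - K * δ ^ 2 := by linarith
    have hrq : 0 ≤ ρ ^ 2 / (1 - K * δ ^ 2) := by positivity
    have hout : ∀ x, 0 < φ x → ‖x‖ ≤ r := by
      intro x hx
      by_contra hh
      push Not at hh
      have h1 : R ≤ ‖x‖ := by linarith [le_abs_self R]
      have h2 := hg2 x h1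
      have h3 : ρ ^ 2 / (1 - K * δ ^ 2) ≤ ‖x‖ ^ 2 := by
        have : 1 ≤ ‖x‖ := by linarith [abs_nonneg R]
        have : ρ ^ 2 / (1 - K * δ ^ 2) ≤ ‖x‖ := by linarith [abs_nonneg R]
        nlinarith
      rw [div_le_iff₀ hd] at h3
      simp only [hφ] at hx
      nlinarith
    have hFc : Continuous fun x => φ x * V x ^ s :=
      hφc.mul (hVc.rpow_const fun x => Or.inl (hVpos x).ne')
    have hpr : p ∈ Metric.closedBall (0 : EuclideanSpace ℝ (Fin n)) r := by
      simpa using hout p (by linarith)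
    obtain ⟨z, hzr, hz⟩ := (isCompact_closedBall (0 : EuclideanSpace ℝ (Fin n)) r).exists_isMaxOn
      ⟨p, hpr⟩ hFc.continuousOn
    have hzp : φ p * V p ^ s ≤ φ z * V z ^ s := hz hpr
    have hVs : ∀ x, 0 < V x ^ s := fun x => Real.rpow_pos_of_pos (hVpos x) s
    have hφz : 0 < φ z := by
      have : 0 < φ z * V z ^ s := lt_of_lt_of_le (mul_pos (by linarith) (hVs p)) hzp
      exact pos_of_mul_pos_left this (hVs z).le
    have hcore := slag_core hn ε hε K ρ c u hu hsym hc hl z hφz (by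
      intro x hx
      have h1 : φ x * V x ^ s ≤ φ z * V z ^ s := hz (by simpa using hout x hx)
      have h2 := Real.log_le_log (mul_pos hx (hVs x)) h1
      rw [Real.log_mul hx.ne' (hVs x).ne', Real.log_mul hφz.ne' (hVs z).ne',
        Real.log_rpow (hVpos x), Real.log_rpow (hVpos z)] at h2
      exact h2)
    have hVz : V z ≤ M := Finset.prod_le_prod (fun i _ => Real.sqrt_nonneg _) fun i _ =>
      Real.sqrt_le_sqrt (slag_eig_bound _ K hK0 hK hcore i)
    have hVzs : V z ^ s ≤ M ^ s := Real.rpow_le_rpow (hVpos z).le hVz hs0.le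
    calc (ρ ^ 2 - ‖p‖ ^ 2) * V p ^ s ≤ φ p * V p ^ s :=
          mul_le_mul_of_nonneg_right hφp (hVs p).le
      _ ≤ φ z * V z ^ s := hzp
      _ ≤ (ρ ^ 2 + B) * M ^ s := mul_le_mul (hφle ρ z) hVzs (hVs z).le (by positivity)
  by_contra hh
  push Not at hh
  have hlt : M ^ s < V p ^ s := Real.rpow_lt_rpow hM0 hh hs0
  have hMs : 0 ≤ M ^ s := Real.rpow_nonneg hM0 s
  set a := V p ^ s
  set m := M ^ s
  have hpos : 0 < a - m := by linarith
  set q := (‖p‖ ^ 2 * a + B * m) / (a - m) with hq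
  have hq0 : 0 ≤ q := by
    have : 0 ≤ a := by linarith
    positivity
  have h1 := key (‖p‖ + 1 + q) (by linarith)
  have h2 : q < (‖p‖ + 1 + q) ^ 2 := by nlinarith [norm_nonneg p]
  rw [hq, div_lt_iff₀ hpos, ← hq] at h2
  nlinarith


/-- Step 1 in the proof of Theorem 1.1: the global Hessian bound
`|D²u(p)| ≤ C(n, δ, ε)` from the restricted linear growth of the gradient. -/
theorem stmt_17 {n : ℕ} (hn : 2 ≤ n) (ε : ℝ) (hε : 0 < ε)
    (δ : ℝ) (hδ0 : 0 ≤ δ) (hδ : δ < 1 / Real.sqrt ((n : ℝ) - 1)) :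
    ∃ C : ℝ, ∀ R : ℝ, 0 < R →
      ∀ (c : ℝ) (u : EuclideanSpace ℝ (Fin n) → ℝ),
        ContDiff ℝ (⊤ : ℕ∞) u →
        ∀ hsym : ∀ x : EuclideanSpace ℝ (Fin n), (Hess u x).IsHermitian,
        (∀ x, ∑ i, Real.arctan ((hsym x).eigenvalues i) = c) →
        (∀ x, ∀ i j : Fin n,
          0 ≤ 3 + (1 - ε) * ((hsym x).eigenvalues i) ^ 2 +
            2 * (hsym x).eigenvalues i * (hsym x).eigenvalues j) →
        (∀ x : EuclideanSpace ℝ (Fin n), R ≤ ‖x‖ → ‖gradient u x‖ ≤ δ * ‖x‖) →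
        ∀ (p : EuclideanSpace ℝ (Fin n)) (i : Fin n), |(hsym p).eigenvalues i| ≤ C := by
  have hnr : (2:ℝ) ≤ n := by exact_mod_cast hn
  have hN : (1:ℝ) ≤ (n:ℝ) - 1 := by linarith
  have hsq : 0 < Real.sqrt ((n:ℝ) - 1) := Real.sqrt_pos.mpr (by linarith)
  rw [lt_div_iff₀ hsq] at hδ
  have h1 : δ ^ 2 * ((n:ℝ) - 1) < 1 := by
    have h2 : (δ * Real.sqrt ((n:ℝ) - 1)) ^ 2 < 1 := by
      have : 0 ≤ δ * Real.sqrt ((n:ℝ) - 1) := by positivity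
      nlinarith
    rwa [mul_pow, Real.sq_sqrt (by linarith)] at h2
  have h3 : δ ^ 2 < 1 := by nlinarith [sq_nonneg δ]
  obtain ⟨K, hK⟩ : ∃ K : ℝ, K = ((n:ℝ) - 1) + (1 - δ ^ 2 * ((n:ℝ) - 1)) / 2 := ⟨_, rfl⟩
  have hK1 : (n:ℝ) - 1 < K := by rw [hK]; linarith
  have hKδ : K * δ ^ 2 < 1 := by rw [hK]; nlinarith
  refine ⟨∏ _i : Fin n, Real.sqrt ((K + 1) / (K - ((n:ℝ) - 1))), ?_⟩
  intro R _ c u hu hsym hc hl hgr p i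
  refine le_trans ?_ (slag_main (by omega) ε hε δ K R c (by linarith) hK1 hKδ u hu hsym hc hl hgr p)
  have h4 : |(hsym p).eigenvalues i| ≤ Real.sqrt (1 + (hsym p).eigenvalues i ^ 2) :=
    Real.abs_le_sqrt (by linarith)
  refine h4.trans ?_
  rw [← Finset.mul_prod_erase _ _ (Finset.mem_univ i)]
  refine le_mul_of_one_le_right (Real.sqrt_nonneg _) (Finset.one_le_prod fun j _ => ?_)
  rw [Real.one_le_sqrt]
  nlinarith [sq_nonneg ((hsym p).eigenvalues j)]
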